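/- arXiv:2003.11333 — 3 statements merged into one kernel-verified Lean document; each statement's English description precedes it below -/
import Mathlib

section
/- Let n ≥ 1, let θ ≥ 0, and let γ_1, …, γ_n be positive reals with γ_max = max_{j=1..n} γ_j. Let h be a hyperbox with lower bounds v_j and upper bounds w_j satisfying v_j ≤ w_j for all j, and let X be an input hyperbox with lower bounds x^l_j and upper bounds x^u_j satisfying x^l_j ≤ x^u_j and x^u_j − x^l_j ≤ θ for all j. If the membership value b_h(X) = min_{j=1..n} min(1 − f(x^u_j − w_j, γ_j), 1 − f(v_j − x^l_j, γ_j)) satisfies b_h(X) < 1 − θ·γ_max, then there exists a dimension j with max(w_j, x^u_j) − min(v_j, x^l_j) > θ; i.e., the hyperbox obtained by expanding h to cover X violates the maximum hyperbox size condition in some dimension. -/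
/-- The ramp function `f(z, γ) = max(0, min(1, z·γ))`. -/
noncomputable def ramp (z γ : ℝ) : ℝ := max 0 (min 1 (z * γ))

/-- A ramp value above `θ * c`, with `c` at least the slope, forces the argument above `θ`. -/
theorem lt_of_mul_lt_ramp {z γ θ c : ℝ} (hθ : 0 ≤ θ) (hγ : 0 < γ) (hc : γ ≤ c)
    (h : θ * c < ramp z γ) : θ < z := by
  have hθγ : θ * γ < ramp z γ := (mul_le_mul_of_nonneg_left hc hθ).trans_lt h
  rcases lt_max_iff.1 hθγ with h0 | h1
  · exact absurd h0 (mul_nonneg hθ hγ.le).not_gt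
  · exact lt_of_mul_lt_mul_right (lt_min_iff.1 h1).2 hγ.le

theorem stmt_0 (n : ℕ) (hn : 1 ≤ n) (θ : ℝ) (hθ : 0 ≤ θ)
    (γ : Fin n → ℝ) (hγ : ∀ j, 0 < γ j)
    (v w xl xu : Fin n → ℝ)
    (hvw : ∀ j, v j ≤ w j) (hx : ∀ j, xl j ≤ xu j)
    (hsize : ∀ j, xu j - xl j ≤ θ)
    (hb : Finset.univ.inf' (Finset.univ_nonempty_iff.2 ⟨⟨0, hn⟩⟩)
        (fun j => min (1 - ramp (xu j - w j) (γ j)) (1 - ramp (v j - xl j) (γ j)))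
      < 1 - θ * Finset.univ.sup' (Finset.univ_nonempty_iff.2 ⟨⟨0, hn⟩⟩) γ) :
    ∃ j, max (w j) (xu j) - min (v j) (xl j) > θ := by
  obtain ⟨j, -, hj⟩ := (Finset.inf'_lt_iff _).1 hb
  have hc := Finset.le_sup' γ (Finset.mem_univ j)
  refine ⟨j, ?_⟩
  have hw := le_max_left (w j) (xu j)
  have hxu := le_max_right (w j) (xu j)
  have hv := min_le_left (v j) (xl j)
  have hxl := min_le_right (v j) (xl j)
  rcases min_lt_iff.1 hj with h | h
  · have := lt_of_mul_lt_ramp hθ (hγ j) hc (by linarith : _ < ramp (xu j - w j) (γ j))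
    linarith [hvw j]
  · have := lt_of_mul_lt_ramp hθ (hγ j) hc (by linarith : _ < ramp (v j - xl j) (γ j))
    linarith [hvw j]
end

section
/- Let θ ≥ 0, γ > 0, and real numbers x^l, v, w, x^u with x^l ≤ v ≤ w ≤ x^u and x^u − x^l ≤ θ. Then the one-dimensional membership value satisfies b = min(1 − f(x^u − w, γ), 1 − f(v − x^l, γ)) ≥ 1 − θ·γ. -/
theorem ramp_le_mul {z θ γ : ℝ} (hθ : 0 ≤ θ) (hγ : 0 ≤ γ) (hz : z ≤ θ) :
    ramp z γ ≤ θ * γ :=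
  max_le (mul_nonneg hθ hγ) ((min_le_right _ _).trans (mul_le_mul_of_nonneg_right hz hγ))

theorem stmt_4 (θ γ xl v w xu : ℝ) (hθ : 0 ≤ θ) (hγ : 0 < γ)
    (h1 : xl ≤ v) (h2 : v ≤ w) (h3 : w ≤ xu) (hsize : xu - xl ≤ θ) :
    min (1 - ramp (xu - w) γ) (1 - ramp (v - xl) γ) ≥ 1 - θ * γ := by
  apply le_min
  · exact sub_le_sub_left (ramp_le_mul hθ hγ.le (by linarith)) 1
  · exact sub_le_sub_left (ramp_le_mul hθ hγ.le (by linarith)) 1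
end

section
/- Let θ ≥ 0, γ > 0, and real numbers v_i ≤ w_i and v_k ≤ w_k. If the one-dimensional shortest-distance-based similarity value s̃ = min(1 − f(v_k − w_i, γ), 1 − f(v_i − w_k, γ)) satisfies s̃ < 1 − θ·γ, then max(w_i, w_k) − min(v_i, v_k) > θ. -/
/-- If the ramp at `z` exceeds the nonnegative level `θ * γ`, then `z` exceeds `θ`. -/
theorem lt_of_lt_ramp {θ γ z : ℝ} (hθ : 0 ≤ θ) (hγ : 0 < γ) (h : θ * γ < ramp z γ) :
    θ < z := by
  rcases lt_max_iff.mp h with h | h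
  · exact absurd h (mul_nonneg hθ hγ.le).not_gt
  · exact lt_of_mul_lt_mul_right (lt_min_iff.mp h).2 hγ.le

theorem stmt_11 (θ γ vi wi vk wk : ℝ) (hθ : 0 ≤ θ) (hγ : 0 < γ)
    (hi : vi ≤ wi) (hk : vk ≤ wk)
    (hs : min (1 - ramp (vk - wi) γ) (1 - ramp (vi - wk) γ) < 1 - θ * γ) :
    max wi wk - min vi vk > θ := by
  rcases min_lt_iff.mp hs with h | h
  · have hlt : θ < vk - wi := lt_of_lt_ramp hθ hγ (by linarith)
    linarith [le_max_right wi wk, min_le_left vi vk]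
  · have hlt : θ < vi - wk := lt_of_lt_ramp hθ hγ (by linarith)
    linarith [le_max_left wi wk, min_le_right vi vk]
end
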